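/- Let (X,d) be a complete separable metric space, α, β ∈ (0,1), ρ > 0, and T ⊆ X. If player II has a winning strategy in the non-tangent (α,β,ρ) Schmidt's game with target set T, then player II has a winning strategy τ with the following property: for every rule-following position p of odd length (i.e., ending with a move by I), the one-round response map sending I's last move to τ's response takes only countably many values, and the preimage of each value is a Borel subset of X × ℝ_{>0}. -/

import Mathlib

open Filter Topology

/-- The history (the list of moves) of the first `n` moves of the run `f`. -/
def histOf {M : Type*} (f : ℕ → M) (n : ℕ) : List M := (List.range n).map f

/-- The axiom of determinacy `AD` for integer games: for every payoff set
`A ⊆ ℕ^ℕ`, in the game where I plays `x (2k)` and II plays `x (2k+1)`, and I wins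
iff `x ∈ A`, one of the players has a winning strategy. -/
def AD : Prop :=
  ∀ A : Set (ℕ → ℕ),
    (∃ σ : List ℕ → ℕ, ∀ x : ℕ → ℕ, (∀ k, x (2 * k) = σ (histOf x (2 * k))) → x ∈ A) ∨
    (∃ τ : List ℕ → ℕ, ∀ x : ℕ → ℕ, (∀ k, x (2 * k + 1) = τ (histOf x (2 * k + 1))) → x ∉ A)

/-- A specification of an infinite two-player game with moves in `M`:
`firstOK` constrains the first move, `moveOK` constrains every single move,
`stepOK i` constrains consecutive moves (at indices `i`, `i+1`), and `payoffII`
is the winning condition for player II on rule-following runs. -/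
structure GameSpec (M : Type*) where
  firstOK : M → Prop
  moveOK : M → Prop
  stepOK : ℕ → M → M → Prop
  payoffII : (ℕ → M) → Prop

namespace GameSpec

variable {M : Type*} (G : GameSpec M)

/-- The first `n` moves of the run `f` follow the rules. -/
def LegalUpTo (f : ℕ → M) (n : ℕ) : Prop :=
  (0 < n → G.firstOK (f 0)) ∧ (∀ i < n, G.moveOK (f i)) ∧
    ∀ i, i + 1 < n → G.stepOK i (f i) (f (i + 1))

/-- The whole run `f` follows the rules. -/
def Legal (f : ℕ → M) : Prop :=
  G.firstOK (f 0) ∧ (∀ i, G.moveOK (f i)) ∧ ∀ i, G.stepOK i (f i) (f (i + 1))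

/-- A finite position (a finite sequence of moves) follows the rules. -/
def ListLegal (p : List M) : Prop :=
  ∃ f : ℕ → M, histOf f p.length = p ∧ G.LegalUpTo f p.length

/-- Player I (who makes the even-indexed moves) follows strategy `σ` in the run `f`. -/
def FollowsI (σ : List M → M) (f : ℕ → M) : Prop :=
  ∀ k, f (2 * k) = σ (histOf f (2 * k))

/-- Player II (who makes the odd-indexed moves) follows strategy `τ` in the run `f`. -/
def FollowsII (τ : List M → M) (f : ℕ → M) : Prop :=
  ∀ k, f (2 * k + 1) = τ (histOf f (2 * k + 1))

/-- `σ` is a winning strategy for player I: whenever player I follows `σ`, player I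
never violates the rules first, and if the whole run follows the rules then the run
is won by player I (i.e. it does not satisfy player II's payoff condition). -/
def WinningI (σ : List M → M) : Prop :=
  ∀ f : ℕ → M, FollowsI σ f →
    (∀ n, G.LegalUpTo f (2 * n) → G.LegalUpTo f (2 * n + 1)) ∧
      (G.Legal f → ¬ G.payoffII f)

/-- `τ` is a winning strategy for player II: whenever player II follows `τ`, player II
never violates the rules first, and if the whole run follows the rules then the run
satisfies player II's payoff condition. -/
def WinningII (τ : List M → M) : Prop :=
  ∀ f : ℕ → M, FollowsII τ f →
    (∀ n, G.LegalUpTo f (2 * n + 1) → G.LegalUpTo f (2 * n + 2)) ∧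
      (G.Legal f → G.payoffII f)

/-- The game is determined: one of the two players has a winning strategy. -/
def Determined : Prop := (∃ σ, G.WinningI σ) ∨ (∃ τ, G.WinningII τ)

end GameSpec

/-- Schmidt's `(α, β)` game on the metric space `X` with target set `T`.
Moves are pairs `(center, radius)`; the first radius must be positive, each ball
must be contained in the previous one (`ρ_{i+1} + d(x_i, x_{i+1}) ≤ ρ_i`), radii
shrink by `α` after an even-indexed (player I) move and by `β` after an
odd-indexed (player II) move.  Player II wins a rule-following run iff the unique
point of intersection of the balls (the limit of the centers) lies in `T`. -/
def schmidtGame {X : Type*} [MetricSpace X] (α β : ℝ) (T : Set X) :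
    GameSpec (X × ℝ) where
  firstOK m := 0 < m.2
  moveOK _ := True
  stepOK i prev next :=
    next.2 + dist prev.1 next.1 ≤ prev.2 ∧ next.2 = (if Even i then α else β) * prev.2
  payoffII f := ∃ z ∈ T, Tendsto (fun n => (f n).1) atTop (𝓝 z)

/-- Schmidt's `(α, β, ρ)` game: like the `(α, β)` game but the first radius must be `ρ`. -/
def schmidtGameFixed {X : Type*} [MetricSpace X] (α β ρ : ℝ) (T : Set X) :
    GameSpec (X × ℝ) :=
  { schmidtGame α β T with firstOK := fun m => m.2 = ρ }

/-- The non-tangent `(α, β, ρ)` Schmidt game on `X` with target set `T`: like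
Schmidt's `(α, β, ρ)` game, but each ball must be non-tangent to the previous one,
i.e. `ρ_{i+1} + d(x_i, x_{i+1}) < ρ_i`. -/
def nonTangentSchmidtGame {X : Type*} [MetricSpace X] (α β ρ : ℝ) (T : Set X) :
    GameSpec (X × ℝ) where
  firstOK m := m.2 = ρ
  moveOK _ := True
  stepOK i prev next :=
    next.2 + dist prev.1 next.1 < prev.2 ∧ next.2 = (if Even i then α else β) * prev.2
  payoffII f := ∃ z ∈ T, Tendsto (fun n => (f n).1) atTop (𝓝 z)


theorem histOf_succ {M : Type*} (f : ℕ → M) (n : ℕ) :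
    histOf f (n + 1) = histOf f n ++ [f n] := by
  simp [histOf, List.range_succ]

theorem histOf_congr {M : Type*} {f g : ℕ → M} {n : ℕ} (h : ∀ i < n, f i = g i) :
    histOf f n = histOf g n :=
  List.map_congr_left fun i hi => h i (List.mem_range.1 hi)

theorem length_histOf {M : Type*} (f : ℕ → M) (n : ℕ) : (histOf f n).length = n := by
  simp [histOf]

/-- Any sequence of moves of player I is part of a run in which II follows `τ`. -/
theorem exists_followsII_of_even {M : Type*} (τ : List M → M) (a : ℕ → M) :
    ∃ g : ℕ → M, GameSpec.FollowsII τ g ∧ ∀ k, g (2 * k) = a (2 * k) := by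
  let hist : ℕ → List M :=
    Nat.rec [] fun n s => s ++ [if Even n then a n else τ s]
  let g : ℕ → M := fun n => if Even n then a n else τ (hist n)
  have hg : ∀ n, histOf g n = hist n := by
    intro n
    induction n with
    | zero => rfl
    | succ n ih => rw [histOf_succ, ih]
  refine ⟨g, fun k => ?_, fun k => ?_⟩
  · rw [hg]
    simp [g]
  · simp [g]

/-- Two runs in which II follows `τ` agree as long as the moves of player I agree. -/
theorem GameSpec.FollowsII.eq_of_even {M : Type*} {τ : List M → M} {f g : ℕ → M}
    (hf : GameSpec.FollowsII τ f) (hg : GameSpec.FollowsII τ g) {n : ℕ}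
    (h : ∀ k, 2 * k < n → f (2 * k) = g (2 * k)) : ∀ i < n, f i = g i := by
  intro i
  induction i using Nat.strong_induction_on with
  | _ i ih =>
    intro hi
    obtain ⟨k, rfl | rfl⟩ := Nat.even_or_odd' i
    · exact h k hi
    · rw [hf k, hg k, histOf_congr fun j hj => ih j hj (hj.trans hi)]

/-- The list `q` with every even-indexed entry `m` replaced by `c s m`, where `s` is the
list obtained from the entries before `m`. -/
def replaceEven {M : Type*} (c : List M → M → M) (q : List M) : List M :=
  q.foldl (fun s m => s ++ [if Even s.length then c s m else m]) []

theorem length_replaceEven {M : Type*} (c : List M → M → M) (q : List M) :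
    (replaceEven c q).length = q.length := by
  induction q using List.reverseRecOn with
  | nil => rfl
  | append_singleton q m ih =>
    rw [replaceEven, List.foldl_append, ← replaceEven]
    simp [ih]

theorem replaceEven_append_singleton {M : Type*} (c : List M → M → M) (q : List M) (m : M) :
    replaceEven c (q ++ [m]) = replaceEven c q ++
      [if Even q.length then c (replaceEven c q) m else m] := by
  conv_lhs => rw [replaceEven, List.foldl_append, ← replaceEven]
  simp [length_replaceEven]

theorem exists_index_measurable {M : Type*} [MeasurableSpace M] {W : ℕ → Set M}
    (hW : ∀ i, MeasurableSet (W i)) :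
    ∃ idx : M → ℕ, Measurable idx ∧ ∀ m, (∃ i, m ∈ W i) → m ∈ W (idx m) := by
  classical
  have hp : ∀ m, ∃ i, m ∈ W i ∨ ∀ j, m ∉ W j := by
    intro m
    by_cases h : ∃ i, m ∈ W i
    · exact h.imp fun _ => Or.inl
    · exact ⟨0, Or.inr (not_exists.1 h)⟩
  refine ⟨fun m => Nat.find (hp m), measurable_find hp fun k => ?_, fun m hm => ?_⟩
  · have : {m | m ∈ W k ∨ ∀ j, m ∉ W j} = W k ∪ ⋂ j, (W j)ᶜ := by
      ext m; simp
    rw [this]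
    exact (hW k).union (MeasurableSet.iInter fun j => (hW j).compl)
  · exact (Nat.find_spec (hp m)).resolve_right fun h => hm.elim h

/-- A Lindelöf selection: a family of open sets indexed by a set `A` has a countable-valued
Borel choice function picking, for each point covered by the family, a member containing it. -/
theorem exists_measurable_selection {M : Type*} [TopologicalSpace M] [SecondCountableTopology M]
    [MeasurableSpace M] [OpensMeasurableSpace M] [Nonempty M] (A : Set M) {W : M → Set M}
    (hW : ∀ a, IsOpen (W a)) :
    ∃ (e : ℕ → M) (idx : M → ℕ), Measurable idx ∧
      ∀ m, (∃ a ∈ A, m ∈ W a) → e (idx m) ∈ A ∧ m ∈ W (e (idx m)) := by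
  obtain hA | hA := A.eq_empty_or_nonempty
  · exact ⟨fun _ => Classical.arbitrary M, fun _ => 0, measurable_const, by simp [hA]⟩
  obtain ⟨C, hCA, hC, hU⟩ := TopologicalSpace.isOpen_biUnion_countable A W fun a _ => hW a
  obtain ⟨a₀, ha₀⟩ := hA
  obtain ⟨e, he⟩ := (hC.union (Set.countable_singleton a₀)).exists_eq_range ⟨a₀, by simp⟩
  have heA : ∀ i, e i ∈ A := by
    intro i
    have : e i ∈ C ∪ {a₀} := he ▸ Set.mem_range_self i
    rcases this with h | h
    · exact hCA h
    · exact h ▸ ha₀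
  obtain ⟨idx, hidx, hmem⟩ :=
    exists_index_measurable (W := fun i => W (e i)) fun i => (hW _).measurableSet
  refine ⟨e, idx, hidx, fun m ⟨a, ha, hm⟩ => ⟨heA _, hmem m ?_⟩⟩
  have : m ∈ ⋃ i ∈ C, W i := hU ▸ Set.mem_biUnion ha hm
  obtain ⟨c, hc, hmc⟩ := Set.mem_iUnion₂.1 this
  obtain ⟨i, rfl⟩ : c ∈ Set.range e := he ▸ Or.inl hc
  exact ⟨i, hmc⟩

section NonTangent

variable {X : Type*} [MetricSpace X]

/-- The moves `m` available to player I after the position `s`: only the last move matters. -/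
def movesAfter (β ρ : ℝ) (s : List (X × ℝ)) : Set (X × ℝ) :=
  {m | (s = [] → m.2 = ρ) ∧
    ∀ a, s.getLast? = some a → m.2 + dist a.1 m.1 < a.2 ∧ m.2 = β * a.2}

theorem movesAfter_radius_eq {β ρ : ℝ} {s : List (X × ℝ)} {m m' : X × ℝ}
    (hm : m ∈ movesAfter β ρ s) (hm' : m' ∈ movesAfter β ρ s) : m.2 = m'.2 := by
  rcases h : s.getLast? with _ | a
  · have hs : s = [] := by simpa using h
    rw [hm.1 hs, hm'.1 hs]
  · rw [(hm.2 a h).2, (hm'.2 a h).2]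

theorem legalUpTo_succ_iff (α β ρ : ℝ) (T : Set X) (f : ℕ → X × ℝ) (n : ℕ) :
    (nonTangentSchmidtGame α β ρ T).LegalUpTo f (2 * n + 1) ↔
      (nonTangentSchmidtGame α β ρ T).LegalUpTo f (2 * n) ∧
        f (2 * n) ∈ movesAfter β ρ (histOf f (2 * n)) := by
  rcases n with _ | n
  · simp [GameSpec.LegalUpTo, nonTangentSchmidtGame, movesAfter, histOf]
  · have h1 : histOf f (2 * (n + 1)) = histOf f (2 * n + 1) ++ [f (2 * n + 1)] :=
      histOf_succ f (2 * n + 1)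
    rw [h1]
    simp only [GameSpec.LegalUpTo, nonTangentSchmidtGame, movesAfter]
    constructor
    · rintro ⟨h, -, hs⟩
      refine ⟨⟨fun _ => h (by omega), by simp, fun i hi => hs i (by omega)⟩, by simp, ?_⟩
      have := hs (2 * n + 1) (by omega)
      simpa [mul_add] using this
    · rintro ⟨⟨h, -, hs⟩, -, hl⟩
      refine ⟨fun _ => h (by omega), by simp, fun i hi => ?_⟩
      obtain hi' | rfl : i + 1 < 2 * (n + 1) ∨ i = 2 * n + 1 := by omega
      · exact hs i hi'
      · simpa [mul_add] using hl

theorem legalUpTo_two_mul_add_two_iff (α β ρ : ℝ) (T : Set X) (f : ℕ → X × ℝ) (n : ℕ) :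
    (nonTangentSchmidtGame α β ρ T).LegalUpTo f (2 * n + 2) ↔
      (nonTangentSchmidtGame α β ρ T).LegalUpTo f (2 * n + 1) ∧
        (f (2 * n + 1)).2 + dist (f (2 * n)).1 (f (2 * n + 1)).1 < (f (2 * n)).2 ∧
        (f (2 * n + 1)).2 = α * (f (2 * n)).2 := by
  simp only [GameSpec.LegalUpTo, nonTangentSchmidtGame]
  constructor
  · rintro ⟨h, -, hs⟩
    refine ⟨⟨fun _ => h (by omega), by simp, fun i hi => hs i (by omega)⟩, ?_⟩
    simpa using hs (2 * n) (by omega)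
  · rintro ⟨⟨h, -, hs⟩, hl⟩
    refine ⟨fun _ => h (by omega), by simp, fun i hi => ?_⟩
    obtain hi' | rfl : i + 1 < 2 * n + 1 ∨ i = 2 * n := by omega
    · exact hs i hi'
    · simpa using hl

theorem GameSpec.legal_iff_forall_legalUpTo {M : Type*} (G : GameSpec M) (f : ℕ → M) :
    G.Legal f ↔ ∀ n, G.LegalUpTo f (2 * n + 1) := by
  constructor
  · rintro ⟨h, hm, hs⟩ n
    exact ⟨fun _ => h, fun i _ => hm i, fun i _ => hs i⟩
  · intro h
    exact ⟨(h 0).1 (by omega), fun i => (h i).2.1 i (by omega),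
      fun i => (h (i + 1)).2.2 i (by omega)⟩

/-- The moves of player I from which the move `y` of player II is a non-tangent subball. -/
def nonTangentTo (y : X × ℝ) : Set (X × ℝ) := {m | y.2 + dist m.1 y.1 < m.2}

theorem isOpen_nonTangentTo (y : X × ℝ) : IsOpen (nonTangentTo y) :=
  isOpen_lt (by fun_prop) (by fun_prop)

/-- A winning strategy for II answers every available move of I legally. -/
theorem mem_nonTangentTo_of_winningII {α β ρ : ℝ} {T : Set X} {τ : List (X × ℝ) → X × ℝ}
    (hτ : (nonTangentSchmidtGame α β ρ T).WinningII τ) {f : ℕ → X × ℝ}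
    (hf : GameSpec.FollowsII τ f) {n : ℕ}
    (hl : (nonTangentSchmidtGame α β ρ T).LegalUpTo f (2 * n)) {m : X × ℝ}
    (hm : m ∈ movesAfter β ρ (histOf f (2 * n))) :
    m ∈ nonTangentTo (τ (histOf f (2 * n) ++ [m])) := by
  obtain ⟨g, hg, hgf⟩ := exists_followsII_of_even τ (Function.update f (2 * n) m)
  have hgn : g (2 * n) = m := by simp [hgf]
  have hlt : ∀ i < 2 * n, g i = f i := hg.eq_of_even hf fun k hk => by
    rw [hgf, Function.update_of_ne (by omega)]
  have hh : histOf g (2 * n) = histOf f (2 * n) := histOf_congr hlt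
  have hl' : (nonTangentSchmidtGame α β ρ T).LegalUpTo g (2 * n + 1) := by
    rw [legalUpTo_succ_iff, hh, hgn]
    refine ⟨⟨fun h0 => hlt 0 h0 ▸ hl.1 h0, fun i hi => hlt i hi ▸ hl.2.1 i hi, fun i hi => ?_⟩, hm⟩
    rw [hlt i (by omega), hlt (i + 1) hi]
    exact hl.2.2 i hi
  have := ((legalUpTo_two_mul_add_two_iff α β ρ T g n).1 ((hτ g hg).1 n hl')).2.1
  rw [hg n, histOf_succ, hh, hgn] at this
  exact this

theorem tendsto_radius_of_legal {α β ρ : ℝ} (hα : α ∈ Set.Ioo (0 : ℝ) 1)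
    (hβ : β ∈ Set.Ioo (0 : ℝ) 1) (hρ : 0 < ρ) {T : Set X} {f : ℕ → X × ℝ}
    (hf : (nonTangentSchmidtGame α β ρ T).Legal f) :
    (∀ n, 0 < (f n).2) ∧ Tendsto (fun n => (f n).2) atTop (𝓝 0) := by
  have key : ∀ n, 0 < (f n).2 ∧ (f n).2 ≤ ρ * max α β ^ n := by
    intro n
    induction n with
    | zero =>
      have h0 : (f 0).2 = ρ := hf.1
      simp [h0, hρ]
    | succ n ih =>
      have h : (f (n + 1)).2 = (if Even n then α else β) * (f n).2 := (hf.2.2 n).2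
      have hpos : 0 < (if Even n then α else β) := by split_ifs <;> [exact hα.1; exact hβ.1]
      have hle : (if Even n then α else β) ≤ max α β := by split_ifs <;> simp
      rw [h]
      refine ⟨mul_pos hpos ih.1, ?_⟩
      calc (if Even n then α else β) * (f n).2 ≤ max α β * (ρ * max α β ^ n) :=
            mul_le_mul hle ih.2 ih.1.le (hpos.le.trans hle)
        _ = ρ * max α β ^ (n + 1) := by ring
  refine ⟨fun n => (key n).1, squeeze_zero (fun n => (key n).1.le) (fun n => (key n).2) ?_⟩
  have := tendsto_pow_atTop_nhds_zero_of_lt_one (hα.1.le.trans (le_max_left α β))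
    (max_lt hα.2 hβ.2)
  simpa using this.const_mul ρ

/-- If `c` replaces each available move `m` of player I by an available move whose `τ`-answer
is also non-tangent to `m`, then answering the replaced moves by `τ` still wins. -/
theorem winningII_comp_replaceEven {α β ρ : ℝ} (hα : α ∈ Set.Ioo (0 : ℝ) 1)
    (hβ : β ∈ Set.Ioo (0 : ℝ) 1) (hρ : 0 < ρ) {T : Set X} {τ : List (X × ℝ) → X × ℝ}
    (hτ : (nonTangentSchmidtGame α β ρ T).WinningII τ)
    {c : List (X × ℝ) → X × ℝ → X × ℝ}
    (hc : ∀ s m, m ∈ movesAfter β ρ s → m ∈ nonTangentTo (τ (s ++ [m])) →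
      c s m ∈ movesAfter β ρ s ∧ m ∈ nonTangentTo (τ (s ++ [c s m]))) :
    (nonTangentSchmidtGame α β ρ T).WinningII fun q => τ (replaceEven c q) := by
  intro f hf
  let f' : ℕ → X × ℝ := fun n => if Even n then c (replaceEven c (histOf f n)) (f n) else f n
  have hist : ∀ n, replaceEven c (histOf f n) = histOf f' n := by
    intro n
    induction n with
    | zero => rfl
    | succ n ih =>
      rw [histOf_succ, histOf_succ, replaceEven_append_singleton, length_histOf, ← ih]
  have hodd : ∀ n, f' (2 * n + 1) = f (2 * n + 1) := fun n => by simp [f']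
  have heven : ∀ n, f' (2 * n) = c (histOf f' (2 * n)) (f (2 * n)) := fun n => by
    rw [← hist]; simp [f']
  have hf' : GameSpec.FollowsII τ f' := fun n => by
    rw [hodd, ← hist]; exact hf n
  have key : ∀ n, (nonTangentSchmidtGame α β ρ T).LegalUpTo f (2 * n + 1) →
      (nonTangentSchmidtGame α β ρ T).LegalUpTo f' (2 * n + 1) ∧ (f (2 * n)).2 = (f' (2 * n)).2 ∧
        f (2 * n) ∈ nonTangentTo (f (2 * n + 1)) := by
    intro n
    induction n with
    | zero =>
      intro h
      have hl : (nonTangentSchmidtGame α β ρ T).LegalUpTo f' (2 * 0) := by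
        simp [GameSpec.LegalUpTo]
      have hA := ((legalUpTo_succ_iff α β ρ T f 0).1 h).2
      have hA' : f (2 * 0) ∈ movesAfter β ρ (histOf f' (2 * 0)) := hA
      obtain ⟨h1, h2⟩ := hc _ _ hA' (mem_nonTangentTo_of_winningII hτ hf' hl hA')
      rw [← heven] at h1 h2
      refine ⟨(legalUpTo_succ_iff α β ρ T f' 0).2 ⟨hl, h1⟩, movesAfter_radius_eq hA' h1, ?_⟩
      rw [← hodd, hf', histOf_succ]
      exact h2
    | succ n ih =>
      intro h
      have hl : (nonTangentSchmidtGame α β ρ T).LegalUpTo f' (2 * (n + 1)) :=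
        (hτ f' hf').1 n (ih ⟨fun _ => h.1 (by omega), fun i hi => h.2.1 i (by omega),
          fun i hi => h.2.2 i (by omega)⟩).1
      have hA := ((legalUpTo_succ_iff α β ρ T f (n + 1)).1 h).2
      have hA' : f (2 * (n + 1)) ∈ movesAfter β ρ (histOf f' (2 * (n + 1))) := by
        have h1 : ∀ g : ℕ → X × ℝ,
            histOf g (2 * (n + 1)) = histOf g (2 * n + 1) ++ [g (2 * n + 1)] :=
          fun g => histOf_succ g (2 * n + 1)
        rw [h1] at hA ⊢
        rw [hodd]
        simpa [movesAfter] using hA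
      obtain ⟨h1, h2⟩ := hc _ _ hA' (mem_nonTangentTo_of_winningII hτ hf' hl hA')
      rw [← heven] at h1 h2
      refine ⟨(legalUpTo_succ_iff α β ρ T f' _).2 ⟨hl, h1⟩, movesAfter_radius_eq hA' h1, ?_⟩
      rw [← hodd, hf', histOf_succ]
      exact h2
  refine ⟨fun n h => ?_, fun h => ?_⟩
  · obtain ⟨h1, h2, h3⟩ := key n h
    refine (legalUpTo_two_mul_add_two_iff α β ρ T f n).2 ⟨h, h3, ?_⟩
    rw [h2, ← hodd]
    exact ((legalUpTo_two_mul_add_two_iff α β ρ T f' n).1 ((hτ f' hf').1 n h1)).2.2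
  · have hn := (GameSpec.legal_iff_forall_legalUpTo _ f).1 h
    have hl' : (nonTangentSchmidtGame α β ρ T).Legal f' :=
      (GameSpec.legal_iff_forall_legalUpTo _ f').2 fun n => (key n (hn n)).1
    obtain ⟨z, hz, hlim⟩ := (hτ f' hf').2 hl'
    obtain ⟨hpos, hrad⟩ := tendsto_radius_of_legal hα hβ hρ h
    refine ⟨z, hz, (tendsto_iff_of_dist ?_).1 hlim⟩
    refine squeeze_zero (fun _ => dist_nonneg) (g := fun n => 2 * (f n).2) (fun n => ?_)
      (by simpa using hrad.const_mul 2)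
    obtain ⟨k, rfl | rfl⟩ := Nat.even_or_odd' n
    · obtain ⟨h1, h2, h3⟩ := key k (hn k)
      have h4 := ((legalUpTo_two_mul_add_two_iff α β ρ T f' k).1 ((hτ f' hf').1 k h1)).2.1
      have h5 : (f (2 * k + 1)).2 + dist (f (2 * k)).1 (f (2 * k + 1)).1 < (f (2 * k)).2 := h3
      rw [hodd] at h4
      have := dist_triangle_right (f' (2 * k)).1 (f (2 * k)).1 (f (2 * k + 1)).1
      have := hpos (2 * k + 1)
      linarith
    · rw [hodd, dist_self]
      have := hpos (2 * k + 1)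
      positivity

end NonTangent

/-- If player II has a winning strategy in the non-tangent `(α, β, ρ)` Schmidt
game on a complete separable metric space `X` with target set `T`, then player II
has a winning strategy `τ` which is *simple*: for every rule-following position
`p` of odd length (ending with a move of player I), the one-round response map
sending player I's last move (with positive radius) to `τ`'s response takes only
countably many values, and the preimage of each value is a Borel subset of
`X × ℝ_{>0}`. -/
theorem playerII_has_simple_winning_strategy_nonTangent
    {X : Type*} [MetricSpace X] [CompleteSpace X] [TopologicalSpace.SeparableSpace X]
    [MeasurableSpace X] [BorelSpace X]
    (α β ρ : ℝ) (hα : α ∈ Set.Ioo (0 : ℝ) 1) (hβ : β ∈ Set.Ioo (0 : ℝ) 1)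
    (hρ : 0 < ρ) (T : Set X)
    (h : ∃ τ, (nonTangentSchmidtGame α β ρ T).WinningII τ) :
    ∃ τ, (nonTangentSchmidtGame α β ρ T).WinningII τ ∧
      ∀ p : List (X × ℝ), Odd p.length → (nonTangentSchmidtGame α β ρ T).ListLegal p →
        Set.Countable ((fun m : X × ℝ => τ (p.dropLast ++ [m])) '' {m : X × ℝ | 0 < m.2}) ∧
        ∀ y : X × ℝ, MeasurableSet {m : X × ℝ | 0 < m.2 ∧ τ (p.dropLast ++ [m]) = y} := by
  obtain ⟨τ, hτ⟩ := h
  have : SecondCountableTopology X := UniformSpace.secondCountable_of_separable X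
  have : Nonempty (X × ℝ) := ⟨τ []⟩
  choose e idx hidx hsel using fun s : List (X × ℝ) =>
    exists_measurable_selection (movesAfter β ρ s) (W := fun m => nonTangentTo (τ (s ++ [m])))
      fun _ => isOpen_nonTangentTo _
  refine ⟨fun q => τ (replaceEven (fun s m => e s (idx s m)) q),
    winningII_comp_replaceEven hα hβ hρ hτ fun s m hm hm' => hsel s m ⟨m, hm, hm'⟩, ?_⟩
  intro p hp _
  have hlen : Even p.dropLast.length := by
    rw [List.length_dropLast]
    exact Nat.Odd.sub_odd hp odd_one
  simp only [replaceEven_append_singleton, hlen, if_true]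
  set s := replaceEven (fun s m => e s (idx s m)) p.dropLast
  refine ⟨(Set.countable_range fun i => τ (s ++ [e s i])).mono ?_, fun y => ?_⟩
  · rintro _ ⟨m, -, rfl⟩
    exact ⟨idx s m, rfl⟩
  · exact (measurableSet_lt measurable_const measurable_snd).inter
      (hidx s (MeasurableSet.of_discrete (s := {i | τ (s ++ [e s i]) = y})))
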